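/- Let n ≥ 3 and let A be a signed graph on n vertices whose underlying graph is the cycle C_n, i.e. there is a bijection g of Fin n such that |A(g i, g j)| = 1 iff i − j ≡ ±1 (mod n). Then for every integer k with 1 ≤ k ≤ n−1, the exterior power ∧^k A is balanced if and only if either (i) A is balanced and k is odd, or (ii) A is not balanced and k is even. -/

import Mathlib

open Matrix Finset

def IsSignedMatrix {ι : Type*} (B : Matrix ι ι ℝ) : Prop :=
  B.IsSymm ∧ (∀ i, B i i = 0) ∧ ∀ i j, B i j = -1 ∨ B i j = 0 ∨ B i j = 1

def IsBalancedMatrix {ι : Type*} [Fintype ι] (B : Matrix ι ι ℝ) : Prop :=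
  ∃ D : Matrix ι ι ℝ, D.IsDiag ∧ (∀ i, D i i = 1 ∨ D i i = -1) ∧
    D * B * D = Matrix.of fun i j => |B i j|

def cartPow {n : ℕ} (A : Matrix (Fin n) (Fin n) ℝ) (k : ℕ) :
    Matrix (Fin k → Fin n) (Fin k → Fin n) ℝ :=
  Matrix.of fun u v => ∑ i : Fin k, A (u i) (v i) *
    ∏ j ∈ Finset.univ.erase i, (if u j = v j then (1 : ℝ) else 0)

noncomputable def enumOf {n k : ℕ} (r : LinearOrder (Fin n)) (S : Finset (Fin n))
    (h : S.card = k) : Fin k → Fin n :=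
  fun i => ((@Finset.orderIsoOfFin (Fin n) r S k h) i : Fin n)

noncomputable def altOf {n : ℕ} (k : ℕ) (r : LinearOrder (Fin n)) :
    Matrix (Fin k → Fin n) {S : Finset (Fin n) // S.card = k} ℝ :=
  Matrix.of fun u S =>
    (Real.sqrt (Nat.factorial k))⁻¹ *
      ∑ π : Equiv.Perm (Fin k),
        if u = enumOf r S.1 S.2 ∘ π then ((Equiv.Perm.sign π : ℤ) : ℝ) else 0

noncomputable def alt (n k : ℕ) :
    Matrix (Fin k → Fin n) {S : Finset (Fin n) // S.card = k} ℝ :=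
  altOf k inferInstance

noncomputable def extPow {n : ℕ} (A : Matrix (Fin n) (Fin n) ℝ) (k : ℕ) :
    Matrix {S : Finset (Fin n) // S.card = k} {S : Finset (Fin n) // S.card = k} ℝ :=
  (alt n k)ᵀ * cartPow A k * alt n k

def IsPathMatrix {n : ℕ} (A : Matrix (Fin n) (Fin n) ℝ) : Prop :=
  ∃ g : Equiv.Perm (Fin n), ∀ i j : Fin n,
    |A (g i) (g j)| = 1 ↔ ((i : ℤ) - j = 1 ∨ (j : ℤ) - i = 1)

def IsCycleMatrix {n : ℕ} (A : Matrix (Fin n) (Fin n) ℝ) : Prop :=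
  3 ≤ n ∧ ∃ g : Equiv.Perm (Fin n), ∀ i j : Fin n,
    |A (g i) (g j)| = 1 ↔
      ((i : ℤ) - j ≡ 1 [ZMOD (n : ℤ)] ∨ (i : ℤ) - j ≡ -1 [ZMOD (n : ℤ)])

def signedAdjGraph {n : ℕ} (A : Matrix (Fin n) (Fin n) ℝ) : SimpleGraph (Fin n) :=
  SimpleGraph.fromRel (fun u v => |A u v| = 1)

/-- The antisymmetrized `k`-fold Cartesian power of `A`, as a function of two tuples. -/
def altKernel {n k : ℕ} (A : Matrix (Fin n) (Fin n) ℝ) (u v : Fin k → Fin n) : ℝ :=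
  ∑ σ : Equiv.Perm (Fin k), ((Equiv.Perm.sign σ : ℤ) : ℝ) * cartPow A k u (v ∘ σ)

/-- A sign function on tuples of distinct vertices is alternating. -/
def IsAltSign {n k : ℕ} (F : (Fin k → Fin n) → ℝ) : Prop :=
  (∀ u, Function.Injective u → F u = 1 ∨ F u = -1) ∧
    ∀ u, Function.Injective u → ∀ π : Equiv.Perm (Fin k),
      F (u ∘ π) = ((Equiv.Perm.sign π : ℤ) : ℝ) * F u

/-- There is an alternating sign function that is compatible with moving a single coordinate of a
tuple of distinct vertices along an edge of `A`. -/
def IsAltBalanced {n : ℕ} (A : Matrix (Fin n) (Fin n) ℝ) (k : ℕ) : Prop :=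
  ∃ F : (Fin k → Fin n) → ℝ, IsAltSign F ∧
    ∀ u, Function.Injective u → ∀ i b, (∀ j, u j ≠ b) →
      F u * F (Function.update u i b) * A (u i) b = |A (u i) b|

theorem sign_mul_self_real {k : ℕ} (π : Equiv.Perm (Fin k)) :
    ((Equiv.Perm.sign π : ℤ) : ℝ) * ((Equiv.Perm.sign π : ℤ) : ℝ) = 1 := by
  rcases Int.units_eq_one_or (Equiv.Perm.sign π) with h | h <;> simp [h]

theorem abs_intCast_sign {k : ℕ} (π : Equiv.Perm (Fin k)) :
    |((Equiv.Perm.sign π : ℤ) : ℝ)| = 1 := by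
  rcases Int.units_eq_one_or (Equiv.Perm.sign π) with h | h <;> simp [h]

theorem update_injective_of_ne {α β : Type*} [DecidableEq α] {u : α → β}
    (hu : Function.Injective u) (i : α) (b : β) (hb : ∀ j, u j ≠ b) :
    Function.Injective (Function.update u i b) := by
  intro p q hpq
  simp only [Function.update_apply] at hpq
  split_ifs at hpq with h1 h2 h2
  · rw [h1, h2]
  · exact absurd hpq.symm (hb q)
  · exact absurd hpq (hb p)
  · exact hu hpq

theorem cartPow_comp {n k : ℕ} (A : Matrix (Fin n) (Fin n) ℝ) (u v : Fin k → Fin n)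
    (π : Equiv.Perm (Fin k)) : cartPow A k (u ∘ π) (v ∘ π) = cartPow A k u v := by
  simp only [cartPow, Matrix.of_apply, Function.comp]
  refine Fintype.sum_equiv π _ _ fun i => ?_
  congr 1
  refine Finset.prod_equiv π (fun j => by simp) fun j _ => rfl

theorem altKernel_comp {n k : ℕ} (A : Matrix (Fin n) (Fin n) ℝ) (u v : Fin k → Fin n)
    (π τ : Equiv.Perm (Fin k)) :
    altKernel A (u ∘ π) (v ∘ τ) =
      ((Equiv.Perm.sign π : ℤ) : ℝ) * ((Equiv.Perm.sign τ : ℤ) : ℝ) * altKernel A u v := by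
  simp only [altKernel, Finset.mul_sum]
  refine Fintype.sum_equiv ((Equiv.mulLeft τ).trans (Equiv.mulRight π⁻¹)) _ _ fun σ => ?_
  have h : cartPow A k u (v ∘ ⇑(τ * σ * π⁻¹)) = cartPow A k (u ∘ π) ((v ∘ τ) ∘ σ) := by
    rw [← cartPow_comp A u _ π]
    congr 1
    ext j
    simp
  simp only [Equiv.trans_apply, Equiv.coe_mulLeft, Equiv.coe_mulRight, h, Equiv.Perm.sign_mul,
    Equiv.Perm.sign_inv, Units.val_mul, Int.cast_mul]
  linear_combination (-((Equiv.Perm.sign σ : ℤ) : ℝ) * cartPow A k (u ∘ π) ((v ∘ τ) ∘ σ)) *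
    (((Equiv.Perm.sign τ : ℤ) : ℝ) * ((Equiv.Perm.sign τ : ℤ) : ℝ) * sign_mul_self_real π +
      sign_mul_self_real τ)

theorem extPow_apply {n k : ℕ} (A : Matrix (Fin n) (Fin n) ℝ)
    (S T : {S : Finset (Fin n) // S.card = k}) :
    extPow A k S T =
      altKernel A (enumOf inferInstance S.1 S.2) (enumOf inferInstance T.1 T.2) := by
  set a := enumOf inferInstance S.1 S.2
  set b := enumOf inferInstance T.1 T.2
  have hc : ((Real.sqrt (Nat.factorial k))⁻¹ * (Real.sqrt (Nat.factorial k))⁻¹) *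
      (Nat.factorial k : ℝ) = 1 := by
    rw [← mul_inv, Real.mul_self_sqrt (by positivity)]
    exact inv_mul_cancel₀ (by positivity)
  have key : ∀ π : Equiv.Perm (Fin k), ∑ σ : Equiv.Perm (Fin k),
      ((Equiv.Perm.sign π : ℤ) : ℝ) * ((Equiv.Perm.sign σ : ℤ) : ℝ) *
        cartPow A k (a ∘ π) (b ∘ σ) = altKernel A a b := by
    intro π
    have h := altKernel_comp A a b π 1
    simp only [altKernel, Equiv.Perm.sign_one, Equiv.Perm.coe_one, Function.comp_id] at h
    simp only [mul_assoc, ← Finset.mul_sum, h]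
    simp [altKernel, ← mul_assoc, sign_mul_self_real]
  calc extPow A k S T
      = ∑ v, ∑ u, (((Real.sqrt (Nat.factorial k))⁻¹ * ∑ π : Equiv.Perm (Fin k),
          if u = a ∘ π then ((Equiv.Perm.sign π : ℤ) : ℝ) else 0) * cartPow A k u v) *
          ((Real.sqrt (Nat.factorial k))⁻¹ * ∑ σ : Equiv.Perm (Fin k),
          if v = b ∘ σ then ((Equiv.Perm.sign σ : ℤ) : ℝ) else 0) := by
        simp only [extPow, Matrix.mul_apply, Finset.sum_mul, Matrix.transpose_apply, alt, altOf,
          Matrix.of_apply, a, b]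
    _ = ((Real.sqrt (Nat.factorial k))⁻¹ * (Real.sqrt (Nat.factorial k))⁻¹) *
          ∑ v, ∑ u, ∑ π : Equiv.Perm (Fin k), ∑ σ : Equiv.Perm (Fin k),
            if v = b ∘ σ then (if u = a ∘ π then ((Equiv.Perm.sign π : ℤ) : ℝ) *
              ((Equiv.Perm.sign σ : ℤ) : ℝ) * cartPow A k u v else 0) else 0 := by
        simp only [Finset.mul_sum]
        refine Finset.sum_congr rfl fun v _ => Finset.sum_congr rfl fun u _ => ?_
        simp only [Finset.sum_mul]
        rw [Finset.sum_comm]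
        refine Finset.sum_congr rfl fun π _ => Finset.sum_congr rfl fun σ _ => ?_
        split_ifs <;> ring
    _ = ((Real.sqrt (Nat.factorial k))⁻¹ * (Real.sqrt (Nat.factorial k))⁻¹) *
          ∑ π : Equiv.Perm (Fin k), ∑ σ : Equiv.Perm (Fin k), ((Equiv.Perm.sign π : ℤ) : ℝ) *
              ((Equiv.Perm.sign σ : ℤ) : ℝ) * cartPow A k (a ∘ π) (b ∘ σ) := by
        congr 1
        rw [Finset.sum_comm' (t' := Finset.univ) (s' := fun _ => Finset.univ) (by simp)]
        simp only [Finset.sum_comm (s := (Finset.univ : Finset (Fin k → Fin n)))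
          (t := (Finset.univ : Finset (Equiv.Perm (Fin k))))]
        simp
    _ = altKernel A a b := by
        simp only [key, Finset.sum_const, Finset.card_univ, Fintype.card_perm, Fintype.card_fin,
          nsmul_eq_mul]
        rw [← mul_assoc, hc, one_mul]

theorem enumOf_injective {n k : ℕ} (S : Finset (Fin n)) (h : S.card = k) :
    Function.Injective (enumOf inferInstance S h) :=
  fun _ _ hij => (S.orderIsoOfFin h).injective (Subtype.ext hij)

theorem range_enumOf {n k : ℕ} (S : Finset (Fin n)) (h : S.card = k) :
    Set.range (enumOf inferInstance S h) = S := by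
  ext x
  constructor
  · rintro ⟨i, rfl⟩
    exact (S.orderIsoOfFin h i).2
  · intro hx
    obtain ⟨i, hi⟩ := (S.orderIsoOfFin h).surjective ⟨x, hx⟩
    exact ⟨i, congrArg Subtype.val hi⟩

theorem exists_enumOf_comp {n k : ℕ} (u : Fin k → Fin n) (hu : Function.Injective u) :
    ∃ (S : {S : Finset (Fin n) // S.card = k}) (π : Equiv.Perm (Fin k)),
      u = enumOf inferInstance S.1 S.2 ∘ π := by
  have hS : (Finset.univ.image u).card = k := by
    rw [Finset.card_image_of_injective _ hu]; simp
  have hmem : ∀ i, ∃ j, enumOf inferInstance _ hS j = u i := by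
    intro i
    have : u i ∈ Set.range (enumOf inferInstance _ hS) := by
      rw [range_enumOf]; simp
    exact this
  choose p hp using hmem
  have hpi : Function.Injective p := fun i j hij => hu (by rw [← hp, ← hp, hij])
  exact ⟨⟨_, hS⟩, Equiv.ofBijective p (Finite.injective_iff_bijective.1 hpi),
    funext fun i => (hp i).symm⟩

theorem enumOf_comp_inj {n k : ℕ} {S T : {S : Finset (Fin n) // S.card = k}}
    {π σ : Equiv.Perm (Fin k)}
    (h : enumOf inferInstance S.1 S.2 ∘ π = enumOf inferInstance T.1 T.2 ∘ σ) :
    S = T ∧ π = σ := by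
  have hST : S = T := by
    apply Subtype.ext
    rw [← Finset.coe_inj, ← range_enumOf S.1 S.2, ← range_enumOf T.1 T.2,
      ← π.surjective.range_comp, h, σ.surjective.range_comp]
  subst hST
  exact ⟨rfl, Equiv.ext fun i => enumOf_injective S.1 S.2 (congrFun h i)⟩

theorem cartPow_eq_zero_or {n k : ℕ} (A : Matrix (Fin n) (Fin n) ℝ) (hA : ∀ i, A i i = 0)
    (u v : Fin k → Fin n) :
    cartPow A k u v = 0 ∨ ∃ i, u i ≠ v i ∧ v = Function.update u i (v i) := by
  by_cases h : cartPow A k u v = 0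
  · exact Or.inl h
  · rw [cartPow, Matrix.of_apply] at h
    obtain ⟨i, -, hi⟩ := Finset.exists_ne_zero_of_sum_ne_zero h
    refine Or.inr ⟨i, fun e => hi (by rw [e, hA, zero_mul]), ?_⟩
    have hp := Finset.prod_ne_zero_iff.1 (right_ne_zero_of_mul hi)
    funext j
    by_cases hj : j = i
    · subst hj; simp
    · rw [Function.update_of_ne hj]
      by_contra hne
      exact hp j (by simp [hj]) (if_neg (Ne.symm hne))

theorem cartPow_update {n k : ℕ} (A : Matrix (Fin n) (Fin n) ℝ) (u : Fin k → Fin n) (i : Fin k)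
    (b : Fin n) (hb : u i ≠ b) : cartPow A k u (Function.update u i b) = A (u i) b := by
  simp only [cartPow, Matrix.of_apply]
  rw [Finset.sum_eq_single i]
  · rw [Finset.prod_eq_one, mul_one, Function.update_self]
    intro j hj
    rw [Function.update_of_ne (Finset.ne_of_mem_erase hj), if_pos rfl]
  · intro j _ hj
    rw [Finset.prod_eq_zero (i := i) (by simp [hj.symm]) (by simp [hb]), mul_zero]
  · simp

theorem altKernel_update {n k : ℕ} (A : Matrix (Fin n) (Fin n) ℝ) (hA : ∀ i, A i i = 0)
    (u : Fin k → Fin n) (hu : Function.Injective u) (i : Fin k) (b : Fin n)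
    (hb : ∀ j, u j ≠ b) : altKernel A u (Function.update u i b) = A (u i) b := by
  rw [altKernel, Finset.sum_eq_single 1]
  · simp [cartPow_update A u i b (hb i)]
  · intro ρ _ hρ
    rcases cartPow_eq_zero_or A hA u (Function.update u i b ∘ ρ) with h | ⟨l, -, hl⟩
    · rw [h, mul_zero]
    · have hfix : ∀ j, j ≠ l → ρ j = j := by
        intro j hj
        have h := congrFun hl j
        rw [Function.update_of_ne hj, Function.comp_apply] at h
        by_cases hi : ρ j = i
        · rw [hi, Function.update_self] at h
          exact absurd h.symm (hb j)
        · rw [Function.update_of_ne hi] at h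
          exact hu h
      refine absurd (Equiv.ext fun j => ?_) hρ
      by_cases hj : j = l
      · subst hj
        by_contra hne
        exact hne (ρ.injective (hfix _ hne))
      · exact hfix j hj
  · simp

theorem isBalancedMatrix_iff {ι : Type*} [Fintype ι] (B : Matrix ι ι ℝ) :
    IsBalancedMatrix B ↔ ∃ d : ι → ℝ, (∀ i, d i = 1 ∨ d i = -1) ∧
      ∀ i j, d i * d j * B i j = |B i j| := by
  classical
  have key : ∀ (d : ι → ℝ) i j,
      (Matrix.diagonal d * B * Matrix.diagonal d) i j = d i * d j * B i j := by
    intro d i j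
    rw [Matrix.mul_diagonal, Matrix.diagonal_mul]
    ring
  constructor
  · rintro ⟨D, hD, h1, h2⟩
    rw [← hD.diagonal_diag] at h2
    exact ⟨D.diag, h1, fun i j => by rw [← key, h2, Matrix.of_apply]⟩
  · rintro ⟨d, h1, h2⟩
    exact ⟨Matrix.diagonal d, Matrix.isDiag_diagonal d, by simpa using h1,
      Matrix.ext fun i j => by rw [key, h2, Matrix.of_apply]⟩

theorem isBalancedMatrix_extPow_iff {n : ℕ} (A : Matrix (Fin n) (Fin n) ℝ)
    (hA : ∀ i, A i i = 0) (k : ℕ) :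
    IsBalancedMatrix (extPow A k) ↔ IsAltBalanced A k := by
  rw [isBalancedMatrix_iff]
  constructor
  · rintro ⟨d, hd, hB⟩
    have hex : ∀ u : Fin k → Fin n, ∃ x : ℝ, Function.Injective u →
        ∃ (S : {S : Finset (Fin n) // S.card = k}) (π : Equiv.Perm (Fin k)),
          u = enumOf inferInstance S.1 S.2 ∘ π ∧ x = ((Equiv.Perm.sign π : ℤ) : ℝ) * d S := by
      intro u
      by_cases hu : Function.Injective u
      · obtain ⟨S, π, h⟩ := exists_enumOf_comp u hu
        exact ⟨_, fun _ => ⟨S, π, h, rfl⟩⟩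
      · exact ⟨0, fun h => absurd h hu⟩
    choose F hF using hex
    refine ⟨F, ⟨fun u hu => ?_, fun u hu ρ => ?_⟩, fun u hu i b hb => ?_⟩
    · obtain ⟨S, π, -, h⟩ := hF u hu
      rw [h]
      rcases Int.units_eq_one_or (Equiv.Perm.sign π) with h1 | h1 <;>
        rcases hd S with h2 | h2 <;> simp [h1, h2]
    · obtain ⟨S, π, hS, h⟩ := hF u hu
      obtain ⟨T, σ, hT, h₂⟩ := hF (u ∘ ρ) (hu.comp ρ.injective)
      have hST : enumOf inferInstance S.1 S.2 ∘ ⇑(π * ρ) = enumOf inferInstance T.1 T.2 ∘ σ := by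
        rw [← hT, hS]
        rfl
      obtain ⟨rfl, rfl⟩ := enumOf_comp_inj hST
      rw [h, h₂, Equiv.Perm.sign_mul]
      push_cast
      ring
    · have hv := update_injective_of_ne hu i b hb
      rw [← altKernel_update A hA u hu i b hb]
      obtain ⟨S, π, hS, h⟩ := hF u hu
      obtain ⟨T, σ, hT, h₂⟩ := hF _ hv
      rw [h, h₂, hT, hS, altKernel_comp, abs_mul, ← extPow_apply, ← hB S T, abs_mul]
      rw [abs_intCast_sign, abs_intCast_sign]
      linear_combination (d S * d T * extPow A k S T) *
        (((Equiv.Perm.sign σ : ℤ) : ℝ) * ((Equiv.Perm.sign σ : ℤ) : ℝ) * sign_mul_self_real π +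
          sign_mul_self_real σ)
  · rintro ⟨F, ⟨hF1, hF2⟩, hF⟩
    refine ⟨fun S => F (enumOf inferInstance S.1 S.2), fun S => hF1 _ (enumOf_injective S.1 S.2),
      fun S T => ?_⟩
    rw [extPow_apply]
    have ha := enumOf_injective S.1 S.2
    have hb := enumOf_injective T.1 T.2
    set a := enumOf inferInstance S.1 S.2
    set b := enumOf inferInstance T.1 T.2
    have hnonneg : 0 ≤ F a * F b * altKernel A a b := by
      rw [altKernel, Finset.mul_sum]
      refine Finset.sum_nonneg fun σ _ => ?_
      have hbσ := hb.comp σ.injective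
      have h2 : F a * F b * (((Equiv.Perm.sign σ : ℤ) : ℝ) * cartPow A k a (b ∘ σ)) =
          F a * F (b ∘ σ) * cartPow A k a (b ∘ σ) := by
        rw [hF2 b hb σ]
        ring
      rw [h2]
      rcases cartPow_eq_zero_or A hA a (b ∘ σ) with h | ⟨i, hi, h⟩
      · rw [h, mul_zero]
      · rw [h, cartPow_update A a i _ hi, hF a ha i _ fun j hj => ?_]
        · exact abs_nonneg _
        · by_cases hji : j = i
          · exact hi (hji ▸ hj)
          · rw [← Function.update_of_ne hji ((b ∘ σ) i) a, ← h] at hj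
            exact hji (hbσ hj)
    rw [← abs_of_nonneg hnonneg, abs_mul, abs_mul]
    rcases hF1 a ha with h1 | h1 <;> rcases hF1 b hb with h2 | h2 <;> simp [h1, h2]

theorem isAltBalanced_one_iff {n : ℕ} (A : Matrix (Fin n) (Fin n) ℝ) (hA : ∀ i, A i i = 0) :
    IsAltBalanced A 1 ↔ IsBalancedMatrix A := by
  rw [isBalancedMatrix_iff]
  constructor
  · rintro ⟨F, ⟨hF1, -⟩, hF⟩
    refine ⟨fun i => F fun _ => i, fun i => hF1 _ (Function.injective_of_subsingleton _),
      fun i j => ?_⟩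
    by_cases hij : i = j
    · simp [hij, hA]
    · have h := hF (fun _ => i) (Function.injective_of_subsingleton _) 0 j fun _ => hij
      rwa [show Function.update (fun _ : Fin 1 => i) 0 j = fun _ => j from
        funext fun p => by rw [Subsingleton.elim p 0, Function.update_self]] at h
  · rintro ⟨d, hd, h⟩
    refine ⟨fun u => d (u 0), ⟨fun u _ => hd _, fun u _ π => ?_⟩, fun u _ i b _ => ?_⟩
    · rw [Subsingleton.elim π 1]
      simp
    · rw [Subsingleton.elim i 0]
      simp [h]

/-- Relabelling the vertices and switching preserves balance of the exterior powers. -/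
theorem IsAltBalanced.reindex {n k : ℕ} {A B : Matrix (Fin n) (Fin n) ℝ} (h : IsAltBalanced A k)
    (g : Equiv.Perm (Fin n)) (d : Fin n → ℝ) (hd : ∀ i, d i = 1 ∨ d i = -1)
    (hB : ∀ i j, B i j = d i * d j * A (g i) (g j)) : IsAltBalanced B k := by
  obtain ⟨F, ⟨hF1, hF2⟩, hF⟩ := h
  have hdd : ∀ i, d i * d i = 1 := fun i => by rcases hd i with h | h <;> simp [h]
  refine ⟨fun u => (∏ i, d (u i)) * F (g ∘ u), ⟨fun u hu => ?_, fun u hu π => ?_⟩,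
    fun u hu i b hb => ?_⟩
  · rw [← sq_eq_one_iff, mul_pow, ← Finset.prod_pow]
    simp only [sq, hdd, Finset.prod_const_one]
    rcases hF1 _ (g.injective.comp hu) with h | h <;> simp [h]
  · simp only [Function.comp_apply]
    rw [Equiv.prod_comp π fun i => d (u i), ← Function.comp_assoc, hF2 _ (g.injective.comp hu)]
    ring
  · have h1 : (∏ j, d (u j)) * ∏ j, d (Function.update u i b j) = d (u i) * d b := by
      rw [← Finset.prod_mul_distrib, Finset.prod_eq_single i]
      · simp
      · intro j _ hj
        rw [Function.update_of_ne hj, hdd]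
      · simp
    have h2 := hF (g ∘ u) (g.injective.comp hu) i (g b) fun j hj => hb j (g.injective hj)
    rw [← Function.comp_update, Function.comp_apply] at h2
    have h3 : |B (u i) b| = |A (g (u i)) (g b)| := by
      rw [hB, abs_mul, abs_mul]
      rcases hd (u i) with h | h <;> rcases hd b with h₂ | h₂ <;> simp [h, h₂]
    rw [h3, ← h2, hB]
    linear_combination (F (g ∘ u) * F (g ∘ Function.update u i b) * A (g (u i)) (g b) *
      (d (u i) * d b)) * h1 + (F (g ∘ u) * F (g ∘ Function.update u i b) * A (g (u i)) (g b)) *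
      (d b * d b * hdd (u i) + hdd b)

theorem isAltBalanced_reindex_iff {n k : ℕ} {A B : Matrix (Fin n) (Fin n) ℝ}
    (g : Equiv.Perm (Fin n)) (d : Fin n → ℝ) (hd : ∀ i, d i = 1 ∨ d i = -1)
    (hB : ∀ i j, B i j = d i * d j * A (g i) (g j)) :
    IsAltBalanced A k ↔ IsAltBalanced B k := by
  have hdd : ∀ i, d i * d i = 1 := fun i => by rcases hd i with h | h <;> simp [h]
  refine ⟨fun h => h.reindex g d hd hB,
    fun h => h.reindex g.symm (fun i => d (g.symm i)) (fun i => hd _) fun i j => ?_⟩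
  simp only [hB, Equiv.apply_symm_apply]
  linear_combination (-A i j) *
    (d (g.symm j) * d (g.symm j) * hdd (g.symm i) + hdd (g.symm j))

/-- The cycle on `Fin n` all of whose edges are positive, except that the edge joining the first
and the last vertex has weight `s`. -/
def cycleMatrix (n : ℕ) (s : ℝ) : Matrix (Fin n) (Fin n) ℝ :=
  Matrix.of fun i j =>
    if (i : ℕ) + 1 = j ∨ (j : ℕ) + 1 = i then 1
    else if ((i : ℕ) = 0 ∧ (j : ℕ) + 1 = n) ∨ ((j : ℕ) = 0 ∧ (i : ℕ) + 1 = n) then s else 0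

theorem exists_switching (x : ℕ → ℝ) (hx : ∀ t, x t = 1 ∨ x t = -1) :
    ∃ e : ℕ → ℝ, (∀ t, e t = 1 ∨ e t = -1) ∧ ∀ t, e t * e (t + 1) * x t = 1 := by
  have he : ∀ t, ∏ r ∈ Finset.range t, x r = 1 ∨ ∏ r ∈ Finset.range t, x r = -1 := by
    intro t
    induction t with
    | zero => simp
    | succ t ih =>
      rw [Finset.prod_range_succ]
      rcases ih with h1 | h1 <;> rcases hx t with h2 | h2 <;> simp [h1, h2]
  refine ⟨fun t => ∏ r ∈ Finset.range t, x r, he, fun t => ?_⟩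
  simp only [Finset.prod_range_succ]
  rcases he t with h1 | h1 <;> rcases hx t with h2 | h2 <;> simp [h1, h2]

theorem IsCycleMatrix.exists_reindex {n : ℕ} {A : Matrix (Fin n) (Fin n) ℝ}
    (hA : IsSignedMatrix A) (hcyc : IsCycleMatrix A) :
    ∃ (g : Equiv.Perm (Fin n)) (d : Fin n → ℝ) (s : ℝ), (∀ i, d i = 1 ∨ d i = -1) ∧
      (s = 1 ∨ s = -1) ∧ ∀ i j, cycleMatrix n s i j = d i * d j * A (g i) (g j) := by
  obtain ⟨hn, g, hg⟩ := hcyc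
  obtain ⟨hsymm, -, hval⟩ := hA
  have habs : ∀ i j : Fin n, |A (g i) (g j)| = 1 ↔
      ((i : ℕ) + 1 = j ∨ (j : ℕ) + 1 = i) ∨
        ((i : ℕ) = 0 ∧ (j : ℕ) + 1 = n) ∨ ((j : ℕ) = 0 ∧ (i : ℕ) + 1 = n) := by
    intro i j
    rw [hg]
    have hi := i.2
    have hj := j.2
    constructor
    · rintro (h | h)
      · obtain ⟨c, hc⟩ := h.dvd
        have h1 : c < 2 := by nlinarith
        have h2 : -1 < c := by nlinarith
        obtain rfl | rfl : c = 0 ∨ c = 1 := by omega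
        all_goals omega
      · obtain ⟨c, hc⟩ := h.dvd
        have h1 : c < 1 := by nlinarith
        have h2 : -2 < c := by nlinarith
        obtain rfl | rfl : c = 0 ∨ c = -1 := by omega
        all_goals omega
    · rintro ((h | h) | h | h)
      · exact Or.inr ((Int.modEq_iff_dvd).2 ⟨0, by omega⟩)
      · exact Or.inl ((Int.modEq_iff_dvd).2 ⟨0, by omega⟩)
      · exact Or.inl ((Int.modEq_iff_dvd).2 ⟨1, by omega⟩)
      · exact Or.inr ((Int.modEq_iff_dvd).2 ⟨-1, by omega⟩)
  have hpm : ∀ i j, |A (g i) (g j)| = 1 → A (g i) (g j) = 1 ∨ A (g i) (g j) = -1 :=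
    fun i j h => (abs_eq zero_le_one).1 h
  have hcomm : ∀ i j, A i j = A j i := fun i j => hsymm.apply j i
  have hedge : ∀ t (h : t + 1 < n), A (g ⟨t, by omega⟩) (g ⟨t + 1, h⟩) = 1 ∨
      A (g ⟨t, by omega⟩) (g ⟨t + 1, h⟩) = -1 := fun t h =>
    hpm _ _ ((habs _ _).2 (Or.inl (Or.inl rfl)))
  have hsw : ∃ e : ℕ → ℝ, (∀ t, e t = 1 ∨ e t = -1) ∧ ∀ t (h : t + 1 < n),
      e t * e (t + 1) * A (g ⟨t, by omega⟩) (g ⟨t + 1, h⟩) = 1 := by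
    obtain ⟨e, he, hee⟩ := exists_switching (fun r => if h : r + 1 < n then
      A (g ⟨r, by omega⟩) (g ⟨r + 1, h⟩) else 1) fun r => by
        split_ifs with h
        · exact hedge r h
        · exact Or.inl rfl
    exact ⟨e, he, fun t h => by simpa only [dif_pos h] using hee t⟩
  obtain ⟨e, he, hee⟩ := hsw
  have hlast := hpm ⟨0, by omega⟩ ⟨n - 1, by omega⟩
    ((habs _ _).2 (Or.inr (Or.inl ⟨rfl, by simp only []; omega⟩)))
  refine ⟨g, fun i => e i, e 0 * e (n - 1) * A (g ⟨0, by omega⟩) (g ⟨n - 1, by omega⟩),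
    fun i => he i, ?_, fun i j => ?_⟩
  · rcases he 0 with h1 | h1 <;> rcases he (n - 1) with h2 | h2 <;> rcases hlast with h3 | h3 <;>
      simp [h1, h2, h3]
  · obtain ⟨i, hi⟩ := i
    obtain ⟨j, hj⟩ := j
    simp only [cycleMatrix, Matrix.of_apply]
    split_ifs with h1 h2
    · rcases h1 with rfl | rfl
      · rw [hee i hj]
      · rw [hcomm, mul_comm (e _), hee j hi]
    · rcases h2 with ⟨rfl, h2⟩ | ⟨rfl, h2⟩
      · obtain rfl : j = n - 1 := by omega
        rfl
      · obtain rfl : i = n - 1 := by omega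
        rw [hcomm, mul_comm (e _)]
    · have h0 : ¬ |A (g ⟨i, hi⟩) (g ⟨j, hj⟩)| = 1 := by
        rw [habs]
        tauto
      rcases hval (g ⟨i, hi⟩) (g ⟨j, hj⟩) with h | h | h
      · exact absurd (by rw [h]; simp) h0
      · rw [h, mul_zero]
      · exact absurd (by rw [h]; simp) h0

/-- The sign of the permutation sorting a tuple of distinct vertices. -/
noncomputable def sortSign {n k : ℕ} (u : Fin k → Fin n) : ℝ :=
  (SignType.sign (Matrix.vandermonde fun i => ((u i : ℕ) : ℝ)).det : ℝ)

theorem sortSign_isAltSign {n k : ℕ} : IsAltSign (sortSign : (Fin k → Fin n) → ℝ) := by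
  constructor
  · intro u hu
    have h : (Matrix.vandermonde fun i => ((u i : ℕ) : ℝ)).det ≠ 0 :=
      Matrix.det_vandermonde_ne_zero_iff.2 fun i j hij => hu (Fin.ext (Nat.cast_injective hij))
    rcases lt_or_gt_of_ne h with h | h
    · right; simp [sortSign, sign_neg h]
    · left; simp [sortSign, sign_pos h]
  · intro u _ π
    have h : (Matrix.vandermonde fun i => (((u ∘ π) i : ℕ) : ℝ)) =
        (Matrix.vandermonde fun i => ((u i : ℕ) : ℝ)).submatrix π id := rfl
    rw [sortSign, h, Matrix.det_permute, sign_mul, sortSign]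
    rcases Int.units_eq_one_or (Equiv.Perm.sign π) with h | h <;> simp [h]

theorem sortSign_cons {n k : ℕ} (a : Fin n) (w : Fin k → Fin n) :
    sortSign (Fin.cons a w : Fin (k + 1) → Fin n) =
      (∏ j, (SignType.sign (((w j : ℕ) : ℝ) - ((a : ℕ) : ℝ)) : ℝ)) * sortSign w := by
  have h : ∀ {ι : Type} (s : Finset ι) (f : ι → ℝ),
      (SignType.sign (∏ i ∈ s, f i) : ℝ) = ∏ i ∈ s, (SignType.sign (f i) : ℝ) := by
    intro ι s f
    induction s using Finset.cons_induction with
    | empty => simp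
    | cons i s hi ih => simp [Finset.prod_cons, sign_mul, ih]
  simp only [sortSign, Matrix.det_vandermonde, h]
  rw [Fin.prod_univ_succ]
  simp

theorem IsAltSign.mul_comp_perm {n k : ℕ} {F : (Fin k → Fin n) → ℝ} (hF : IsAltSign F)
    {u v : Fin k → Fin n} (hu : Function.Injective u) (hv : Function.Injective v)
    (π : Equiv.Perm (Fin k)) : F (u ∘ π) * F (v ∘ π) = F u * F v := by
  rw [hF.2 u hu, hF.2 v hv]
  linear_combination (F u * F v) * sign_mul_self_real π

theorem sortSign_update {n m : ℕ} (u : Fin (m + 1) → Fin n) (hu : Function.Injective u)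
    (i : Fin (m + 1)) (b : Fin n) (hb : ∀ j, u j ≠ b) :
    ∃ w : Fin m → Fin n, (∀ j, w j ≠ u i) ∧ (∀ j, w j ≠ b) ∧
      sortSign u * sortSign (Function.update u i b) =
        ∏ j, (SignType.sign (((w j : ℕ) : ℝ) - ((u i : ℕ) : ℝ)) : ℝ) *
          (SignType.sign (((w j : ℕ) : ℝ) - ((b : ℕ) : ℝ)) : ℝ) := by
  have hv := update_injective_of_ne hu i b hb
  set w : Fin m → Fin n := Fin.tail (u ∘ Equiv.swap 0 i)
  have hs : ∀ j : Fin m, Equiv.swap 0 i j.succ ≠ i := fun j h =>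
    Fin.succ_ne_zero j ((Equiv.swap 0 i).injective (by rw [h, Equiv.swap_apply_left]))
  have h1 : u ∘ Equiv.swap 0 i = Fin.cons (u i) w := by
    conv_lhs => rw [← Fin.cons_self_tail (u ∘ Equiv.swap 0 i)]
    simp [w]
  have h2 : Function.update u i b ∘ Equiv.swap 0 i = Fin.cons b w := by
    funext j
    refine Fin.cases ?_ (fun j => ?_) j
    · simp
    · simp [w, Fin.tail, Function.update_of_ne (hs j)]
  refine ⟨w, fun j h => hs j (hu h), fun j => hb _, ?_⟩
  rw [← sortSign_isAltSign.mul_comp_perm hu hv (Equiv.swap 0 i), h1, h2, sortSign_cons, sortSign_cons,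
    Finset.prod_mul_distrib]
  have hw : sortSign w * sortSign w = 1 := by
    have : Function.Injective w :=
      (hu.comp (Equiv.injective _)).comp (Fin.succ_injective m)
    rcases sortSign_isAltSign.1 w this with h | h <;> simp [h]
  linear_combination (∏ j, (SignType.sign (((w j : ℕ) : ℝ) - ((u i : ℕ) : ℝ)) : ℝ)) *
    (∏ j, (SignType.sign (((w j : ℕ) : ℝ) - ((b : ℕ) : ℝ)) : ℝ)) * hw

theorem isAltBalanced_cycleMatrix {n m : ℕ} {s : ℝ} (hs : s = 1 ∨ s = -1)
    (h : s * (-1) ^ m = 1) : IsAltBalanced (cycleMatrix n s) (m + 1) := by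
  refine ⟨sortSign, sortSign_isAltSign, fun u hu i b hb => ?_⟩
  obtain ⟨w, hwa, hwb, hw⟩ := sortSign_update u hu i b hb
  rw [hw]
  set a := u i
  have hwa' : ∀ j, ((w j : ℕ) ≠ a) := fun j h => hwa j (Fin.ext h)
  have hwb' : ∀ j, ((w j : ℕ) ≠ b) := fun j h => hwb j (Fin.ext h)
  have hsgn : ∀ x y : ℕ, (x < y → (SignType.sign ((x : ℝ) - y) : ℝ) = -1) ∧
      (y < x → (SignType.sign ((x : ℝ) - y) : ℝ) = 1) := by
    intro x y
    constructor
    · intro h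
      rw [sign_neg (sub_neg.2 (Nat.cast_lt.2 h))]; simp
    · intro h
      rw [sign_pos (sub_pos.2 (Nat.cast_lt.2 h))]; simp
  simp only [cycleMatrix, Matrix.of_apply]
  split_ifs with h1 h2
  · rw [Finset.prod_eq_one]
    · simp
    · intro j _
      have := hwa' j
      have := hwb' j
      rcases lt_or_gt_of_ne (hwa' j) with h | h
      · rw [(hsgn _ _).1 h, (hsgn _ _).1 (by omega)]; norm_num
      · rw [(hsgn _ _).2 h, (hsgn _ _).2 (by omega)]; norm_num
  · rw [Finset.prod_congr rfl (g := fun _ => (-1 : ℝ))]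
    · simp only [Finset.prod_const, Finset.card_univ, Fintype.card_fin]
      rw [mul_comm, h]
      rcases hs with h | h <;> simp [h]
    · intro j _
      have := hwa' j
      have := hwb' j
      have := (w j).2
      rcases lt_or_gt_of_ne (hwa' j) with h | h
      · rw [(hsgn _ _).1 h, (hsgn _ _).2 (by omega)]; norm_num
      · rw [(hsgn _ _).2 h, (hsgn _ _).1 (by omega)]; norm_num
  · simp

theorem IsAltBalanced.cycleMatrix_sign {n m : ℕ} {s : ℝ} (hs : s = 1 ∨ s = -1) (hn : 3 ≤ n)
    (hm : m + 2 ≤ n) (h : IsAltBalanced (cycleMatrix n s) (m + 1)) : s * (-1) ^ m = 1 := by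
  obtain ⟨F, ⟨hF1, hF2⟩, hF⟩ := h
  have hstep : ∀ u, Function.Injective u → ∀ i (b : Fin n), (∀ j, u j ≠ b) →
      (u i : ℕ) + 1 = b ∨ (b : ℕ) + 1 = u i → F (Function.update u i b) = F u := by
    intro u hu i b hb hab
    have h := hF u hu i b hb
    rw [show cycleMatrix n s (u i) b = 1 by simp [cycleMatrix, hab], mul_one, abs_one] at h
    rcases hF1 u hu with h1 | h1 <;> rw [h1] at h ⊢ <;> linarith
  -- slide every coordinate up by one, starting from the last
  let U : ℕ → Fin (m + 1) → Fin n := fun t j =>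
    ⟨if (j : ℕ) < t then j else j + 1, by split_ifs <;> omega⟩
  have hU : ∀ t, Function.Injective (U t) := by
    intro t p q hpq
    have := congrArg Fin.val hpq
    simp only [U] at this
    ext
    split_ifs at this <;> omega
  have hUt : ∀ t ≤ m + 1, F (U t) = F (U 0) := by
    intro t
    induction t with
    | zero => simp
    | succ t ih =>
      intro ht
      rw [← ih (by omega)]
      have hupd : U (t + 1) = Function.update (U t) ⟨t, by omega⟩ ⟨t, by omega⟩ := by
        funext j
        by_cases hj : j = ⟨t, by omega⟩
        · subst hj
          simp [U]
        · rw [Function.update_of_ne hj]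
          have : (j : ℕ) ≠ t := fun h => hj (Fin.ext h)
          ext
          simp only [U]
          split_ifs <;> omega
      rw [hupd]
      refine hstep _ (hU t) _ _ (fun j hj => ?_) (Or.inr (by simp [U]))
      have := congrArg Fin.val hj
      simp only [U] at this
      split_ifs at this <;> omega
  let w : Fin m → Fin n := fun j => ⟨j + 1, by omega⟩
  have hW : ∀ b : Fin n, (∀ j, w j ≠ b) →
      Function.Injective (Fin.cons b w : Fin (m + 1) → Fin n) := by
    intro b hb
    rw [Fin.cons_injective_iff]
    exact ⟨fun ⟨j, hj⟩ => hb j hj, fun p q hpq => by simpa [w, Fin.ext_iff] using hpq⟩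
  have hwne : ∀ (b : Fin n), m < (b : ℕ) → ∀ j, w j ≠ b := by
    intro b hb j hj
    have := congrArg Fin.val hj
    simp only [w] at this
    omega
  have hw0 : ∀ j, w j ≠ ⟨0, by omega⟩ := fun j hj => by simp [w] at hj
  have hslide : ∀ t (ht : m + 1 + t < n), F (Fin.cons ⟨m + 1 + t, ht⟩ w : Fin (m + 1) → Fin n) =
      F (Fin.cons ⟨m + 1, by omega⟩ w : Fin (m + 1) → Fin n) := by
    intro t
    induction t with
    | zero => simp
    | succ t ih =>
      intro ht
      have hupd : (Fin.cons ⟨m + 1 + (t + 1), ht⟩ w : Fin (m + 1) → Fin n) =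
          Function.update (Fin.cons ⟨m + 1 + t, by omega⟩ w) 0 ⟨m + 1 + (t + 1), ht⟩ :=
        (Fin.update_cons_zero (α := fun _ => Fin n) _ w _).symm
      rw [← ih (by omega), hupd]
      refine hstep _ (hW _ (hwne _ (by simp only []; omega))) _ _ (fun j => ?_)
        (Or.inl (by simp only [Fin.cons_zero]; omega))
      refine Fin.cases ?_ (fun j => ?_) j
      · simp
      · exact hwne _ (by simp only []; omega) j
  have hwrap : F (Fin.cons ⟨m + 1, by omega⟩ w : Fin (m + 1) → Fin n) *
      F (Fin.cons ⟨0, by omega⟩ w : Fin (m + 1) → Fin n) * s = 1 := by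
    have hlast := hslide (n - 1 - (m + 1)) (by omega)
    rw [← hlast]
    have h := hF _ (hW ⟨m + 1 + (n - 1 - (m + 1)), by omega⟩ (hwne _ (by simp only []; omega))) 0
      ⟨0, by omega⟩ fun j => by
        refine Fin.cases ?_ (fun j => ?_) j
        · simp
        · exact hw0 j
    rw [Fin.update_cons_zero, Fin.cons_zero] at h
    have hval : cycleMatrix n s ⟨m + 1 + (n - 1 - (m + 1)), by omega⟩ ⟨0, by omega⟩ = s := by
      simp only [cycleMatrix, Matrix.of_apply]
      rw [if_neg (by omega), if_pos (Or.inr ⟨trivial, by omega⟩)]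
    rw [hval] at h
    rw [h]
    rcases hs with h | h <;> simp [h]
  have hfirst : U (m + 1) = Fin.cons ⟨0, by omega⟩ w := by
    funext j
    refine Fin.cases ?_ (fun j => ?_) j
    · simp [U]
    · simp [U, w]
  have hrot : U 0 = (Fin.cons ⟨m + 1, by omega⟩ w : Fin (m + 1) → Fin n) ∘ finRotate (m + 1) := by
    funext j
    refine Fin.lastCases ?_ (fun j => ?_) j
    · simp [U]
    · simp [U, w]
  have hfin := hUt (m + 1) le_rfl
  have hinj := hW ⟨m + 1, by omega⟩ (hwne _ (by simp only []; omega))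
  rw [hfirst, hrot, hF2 _ hinj, sign_finRotate] at hfin
  rw [hfin] at hwrap
  push_cast at hwrap
  rcases hF1 _ hinj with h | h <;> rw [h] at hwrap <;> linarith

theorem isAltBalanced_cycleMatrix_iff {n m : ℕ} {s : ℝ} (hs : s = 1 ∨ s = -1) (hn : 3 ≤ n)
    (hm : m + 2 ≤ n) : IsAltBalanced (cycleMatrix n s) (m + 1) ↔ s * (-1) ^ m = 1 :=
  ⟨fun h => h.cycleMatrix_sign hs hn hm, isAltBalanced_cycleMatrix hs⟩

theorem stmt17 {n k : ℕ} (hn : 3 ≤ n)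
    (A : Matrix (Fin n) (Fin n) ℝ) (hA : IsSignedMatrix A)
    (hcyc : IsCycleMatrix A) (hk : 1 ≤ k) (hkn : k ≤ n - 1) :
    IsBalancedMatrix (extPow A k) ↔
      (IsBalancedMatrix A ∧ Odd k) ∨ (¬ IsBalancedMatrix A ∧ Even k) := by
  obtain ⟨m, rfl⟩ : ∃ m, k = m + 1 := ⟨k - 1, by omega⟩
  obtain ⟨g, d, s, hd, hs, hB⟩ := hcyc.exists_reindex hA
  rw [isBalancedMatrix_extPow_iff A hA.2.1, ← isAltBalanced_one_iff A hA.2.1,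
    isAltBalanced_reindex_iff g d hd hB, isAltBalanced_reindex_iff g d hd hB,
    isAltBalanced_cycleMatrix_iff hs hn (by omega),
    isAltBalanced_cycleMatrix_iff (m := 0) hs hn (by omega)]
  rcases Nat.even_or_odd m with hm | hm
  · have h1 : ¬ Even (m + 1) := Nat.not_even_iff_odd.2 hm.add_one
    simp [hm.neg_one_pow, hm.add_one, h1]
  · have h1 : ¬ Odd (m + 1) := Nat.not_odd_iff_even.2 hm.add_one
    rcases hs with h | h <;> norm_num [hm.neg_one_pow, hm.add_one, h1, h]
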